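/- arXiv:2604.18905 — 7 statements merged into one kernel-verified Lean document; each statement's English description precedes it below -/
import Mathlib

section
/- Assume ṁ_max < 4·√(m_min·k_min). Then there exist positive constants c₁ ≤ c₂, λ₁ and Γ such that for every continuous bounded input u : ℝ → ℝ² and every solution ζ of the admittance dynamics with input u, the extended state satisfies, for all t ≥ 0: ‖z(t)‖² ≤ (c₂/c₁)·e^{−λ₁·t}·‖z(0)‖² + (Γ/(λ₁·c₁))·sup_{0 ≤ s ≤ t} ‖u(s)‖² (input-to-state stability of the time-varying admittance system). -/
open Real Set

/-- Gronwall-type comparison: `V' ≤ -lam V + B` on `[0, T]` bounds `V T`. -/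
lemma le_exp_mul_add_of_deriv_le {V V' : ℝ → ℝ} {lam B T : ℝ} (hlam : 0 < lam) (hB : 0 ≤ B)
    (hT : 0 ≤ T) (hV : ∀ t, HasDerivAt V (V' t) t)
    (hle : ∀ t ∈ Icc (0:ℝ) T, V' t ≤ -lam * V t + B) :
    V T ≤ Real.exp (-lam * T) * V 0 + B / lam := by
  have hg : ∀ t, HasDerivAt (fun t => Real.exp (lam * t) * (V t - B / lam))
      (Real.exp (lam * t) * (V' t + lam * V t - B)) t := by
    intro t
    have h1 : HasDerivAt (fun t => Real.exp (lam * t)) (Real.exp (lam * t) * lam) t := by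
      simpa using ((hasDerivAt_id t).const_mul lam).exp
    refine (h1.mul ((hV t).sub_const (B / lam))).congr_deriv ?_
    field_simp
    ring
  have hanti : AntitoneOn (fun t => Real.exp (lam * t) * (V t - B / lam)) (Icc 0 T) := by
    apply antitoneOn_of_deriv_nonpos (convex_Icc 0 T)
    · exact fun t _ => (hg t).continuousAt.continuousWithinAt
    · exact fun t _ => (hg t).differentiableAt.differentiableWithinAt
    · intro t ht
      rw [(hg t).deriv]
      have := hle t (interior_subset ht)
      exact mul_nonpos_of_nonneg_of_nonpos (Real.exp_pos _).le (by linarith)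
  have h := hanti (left_mem_Icc.2 hT) (right_mem_Icc.2 hT) hT
  simp only [mul_zero, Real.exp_zero, one_mul] at h
  have hmul := mul_le_mul_of_nonneg_left h (Real.exp_pos (-lam * T)).le
  rw [← mul_assoc, ← Real.exp_add, neg_mul, neg_add_cancel, Real.exp_zero, one_mul] at hmul
  have hpos : 0 ≤ Real.exp (-(lam * T)) * (B / lam) := by positivity
  rw [neg_mul]
  linarith

/-- The dissipation inequality for the energy with cross term `ε m x y`. -/
lemma energy_dissipation {m m' d K b F δ D ε x y u : ℝ} (hK : 0 < K) (hδ : 0 < δ) (hε : 0 < ε)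
    (hm : m ≤ b) (hm' : |m'| ≤ D) (hd : D / 2 + δ ≤ d) (hF : |m' - d| ≤ F)
    (hεδ : ε * (b + F ^ 2 / K) ≤ δ / 4) :
    m' / 2 * y ^ 2 + y * (u - d * y - K * x) + K * x * y + ε * m' * x * y + ε * m * y ^ 2
        + ε * x * (u - d * y - K * x)
      ≤ -(δ / 2) * y ^ 2 - ε * K / 2 * x ^ 2 + (1 / δ + ε / K) * u ^ 2 := by
  have hcross : (m' - d) * x * y ≤ K / 4 * x ^ 2 + F ^ 2 / K * y ^ 2 := by
    have h1 : (m' - d) ^ 2 ≤ F ^ 2 := sq_le_sq' (by linarith [neg_abs_le (m' - d)])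
      (by linarith [le_abs_self (m' - d)])
    have h2 : (m' - d) ^ 2 / K * y ^ 2 ≤ F ^ 2 / K * y ^ 2 := by gcongr
    have h3 : K / 4 * x ^ 2 + (m' - d) ^ 2 / K * y ^ 2 - (m' - d) * x * y
        = (K * x / 2 - (m' - d) * y) ^ 2 / K := by field_simp; ring
    have h4 : 0 ≤ (K * x / 2 - (m' - d) * y) ^ 2 / K := by positivity
    linarith
  have hux : u * x ≤ K / 4 * x ^ 2 + 1 / K * u ^ 2 := by
    have h3 : K / 4 * x ^ 2 + 1 / K * u ^ 2 - u * x = (K * x / 2 - u) ^ 2 / K := by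
      field_simp; ring
    have h4 : 0 ≤ (K * x / 2 - u) ^ 2 / K := by positivity
    linarith
  have huy : u * y ≤ δ / 4 * y ^ 2 + 1 / δ * u ^ 2 := by
    have h3 : δ / 4 * y ^ 2 + 1 / δ * u ^ 2 - u * y = (δ * y / 2 - u) ^ 2 / δ := by
      field_simp; ring
    have h4 : 0 ≤ (δ * y / 2 - u) ^ 2 / δ := by positivity
    linarith
  have e1 := mul_le_mul_of_nonneg_left hcross hε.le
  have e2 := mul_le_mul_of_nonneg_left hux hε.le
  have e3 := mul_le_mul_of_nonneg_right hεδ (sq_nonneg y)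
  have e4 : ε * m * y ^ 2 ≤ ε * b * y ^ 2 := by gcongr
  have e5 : (m' / 2 - d) * y ^ 2 ≤ -δ * y ^ 2 := by
    apply mul_le_mul_of_nonneg_right _ (sq_nonneg y)
    linarith [le_abs_self m']
  have e6 : ε / K * u ^ 2 = ε * (1 / K * u ^ 2) := by ring
  rw [add_mul, e6]
  linarith

/-- Upper and lower quadratic bounds for the energy with cross term `ε m x y`. -/
lemma energy_bounds {m K a b ε x y : ℝ} (ha : 0 < a) (hε : 0 < ε)
    (hma : a ≤ m) (hmb : m ≤ b) (hεb : ε * b ≤ min a K / 2) :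
    min a K / 4 * (x ^ 2 + y ^ 2) ≤ m / 2 * y ^ 2 + K / 2 * x ^ 2 + ε * m * x * y ∧
      m / 2 * y ^ 2 + K / 2 * x ^ 2 + ε * m * x * y ≤ (b + K) * (x ^ 2 + y ^ 2) := by
  have hεm0 : 0 ≤ ε * m := by nlinarith
  have hεm : ε * m ≤ min a K / 2 := le_trans (by gcongr) hεb
  have h1 := min_le_left a K
  have h2 := min_le_right a K
  have hx := sq_nonneg x
  have hy := sq_nonneg y
  have hp := mul_nonneg hεm0 (sq_nonneg (x + y))
  have hn := mul_nonneg hεm0 (sq_nonneg (x - y))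
  have hs := mul_le_mul_of_nonneg_right hεm (add_nonneg hx hy)
  have h1y : min a K * y ^ 2 ≤ m * y ^ 2 := by gcongr; linarith
  have h2x : min a K * x ^ 2 ≤ K * x ^ 2 := by gcongr
  have h1x : min a K * x ^ 2 ≤ b * x ^ 2 := by gcongr; linarith
  have h2y : min a K * y ^ 2 ≤ K * y ^ 2 := by gcongr
  have hby : m * y ^ 2 ≤ b * y ^ 2 := by gcongr
  have k0 : 0 ≤ min a K := by linarith
  have k1 : 0 ≤ min a K * x ^ 2 := mul_nonneg k0 hx
  have k2 : 0 ≤ min a K * y ^ 2 := mul_nonneg k0 hy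
  constructor <;> nlinarith

/-- Exponential input-to-state stability of a scalar mass-spring-damper with time-varying mass
and damping, with constants depending only on the bounds on the coefficients. -/
lemma scalar_admittance_iss {K a b D δ E : ℝ} (hK : 0 < K) (ha : 0 < a) (hab : a ≤ b)
    (hD : 0 ≤ D) (hδ : 0 < δ) (hE : 0 ≤ E) :
    ∃ C lam G : ℝ, 0 < C ∧ 0 < lam ∧ 0 < G ∧
      ∀ m m' d u x x' x'' : ℝ → ℝ,
        (∀ t, HasDerivAt m (m' t) t) →
        (∀ t ≥ (0:ℝ), a ≤ m t ∧ m t ≤ b ∧ |m' t| ≤ D ∧ D / 2 + δ ≤ d t ∧ d t ≤ E) →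
        (∀ t, HasDerivAt x (x' t) t) → (∀ t, HasDerivAt x' (x'' t) t) →
        (∀ t ≥ (0:ℝ), m t * x'' t + d t * x' t + K * x t = u t) →
        ∀ T ≥ (0:ℝ), ∀ U : ℝ, (∀ t ∈ Icc (0:ℝ) T, u t ^ 2 ≤ U) →
          x T ^ 2 + x' T ^ 2
            ≤ C * Real.exp (-lam * T) * (x 0 ^ 2 + x' 0 ^ 2) + G * U := by
  have hb : 0 < b := ha.trans_le hab
  set c := min a K with hc
  have hc0 : 0 < c := lt_min ha hK
  set F := D + E with hFdef
  have hF0 : 0 ≤ F := add_nonneg hD hE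
  have hq : 0 < b + F ^ 2 / K := by positivity
  obtain ⟨ε, hε, hεb, hεδ⟩ : ∃ ε : ℝ, 0 < ε ∧ ε * b ≤ c / 2 ∧ ε * (b + F ^ 2 / K) ≤ δ / 4 := by
    refine ⟨min (c / 2 / b) (δ / 4 / (b + F ^ 2 / K)), by positivity, ?_, ?_⟩
    · exact (le_div_iff₀ hb).1 (min_le_left _ _)
    · exact (le_div_iff₀ hq).1 (min_le_right _ _)
  set μ := min (δ / 2) (ε * K / 2) with hμ
  have hμ0 : 0 < μ := lt_min (by positivity) (by positivity)
  have hbK : 0 < b + K := by positivity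
  set lam := μ / (b + K) with hlam
  have hlam0 : 0 < lam := by positivity
  set Γ := 1 / δ + ε / K with hΓ
  have hΓ0 : 0 < Γ := by positivity
  refine ⟨(b + K) / (c / 4), lam, Γ / lam / (c / 4), by positivity, hlam0, by positivity, ?_⟩
  intro m m' d u x x' x'' hm hbd hx hx' hode T hT U hU
  have hU0 : 0 ≤ U := (sq_nonneg _).trans (hU 0 (left_mem_Icc.2 hT))
  let V : ℝ → ℝ := fun t => m t / 2 * x' t ^ 2 + K / 2 * x t ^ 2 + ε * m t * x t * x' t
  let V' : ℝ → ℝ := fun t => m' t / 2 * x' t ^ 2 + x' t * (m t * x'' t) + K * x t * x' t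
    + ε * m' t * x t * x' t + ε * m t * x' t ^ 2 + ε * x t * (m t * x'' t)
  have hV : ∀ t, HasDerivAt V (V' t) t := by
    intro t
    refine (((((hm t).div_const 2).mul ((hx' t).pow 2)).add
      (((hx t).pow 2).const_mul (K / 2))).add
      ((((hm t).const_mul ε).mul (hx t)).mul (hx' t))).congr_deriv ?_
    simp only [V', Pi.mul_apply, Pi.pow_apply]
    push_cast
    ring
  have hVbd : ∀ t ≥ (0:ℝ), c / 4 * (x t ^ 2 + x' t ^ 2) ≤ V t ∧
      V t ≤ (b + K) * (x t ^ 2 + x' t ^ 2) := fun t ht =>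
    energy_bounds ha hε (hbd t ht).1 (hbd t ht).2.1 hεb
  have hle : ∀ t ∈ Icc (0:ℝ) T, V' t ≤ -lam * V t + Γ * U := by
    intro t ht
    obtain ⟨-, h2, h3, h4, h5⟩ := hbd t ht.1
    have hFd : |m' t - d t| ≤ F := by
      rw [abs_le] at h3 ⊢
      constructor <;> linarith
    have key := energy_dissipation (x := x t) (y := x' t) (u := u t) hK hδ hε h2 h3 h4 hFd hεδ
    have hmx : m t * x'' t = u t - d t * x' t - K * x t := by linarith [hode t ht.1]
    have h6 : lam * V t ≤ μ * (x t ^ 2 + x' t ^ 2) := by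
      calc lam * V t ≤ lam * ((b + K) * (x t ^ 2 + x' t ^ 2)) := by
            gcongr; exact (hVbd t ht.1).2
        _ = μ * (x t ^ 2 + x' t ^ 2) := by rw [hlam]; field_simp
    have h7 : μ * x' t ^ 2 ≤ δ / 2 * x' t ^ 2 := by gcongr; exact min_le_left _ _
    have h8 : μ * x t ^ 2 ≤ ε * K / 2 * x t ^ 2 := by gcongr; exact min_le_right _ _
    have h9 : Γ * u t ^ 2 ≤ Γ * U := by gcongr; exact hU t ht
    simp only [V', hmx]
    linarith
  have hfin := le_exp_mul_add_of_deriv_le hlam0 (by positivity) hT hV hle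
  have hlow := (hVbd T hT).1
  have h0 : Real.exp (-lam * T) * V 0
      ≤ Real.exp (-lam * T) * ((b + K) * (x 0 ^ 2 + x' 0 ^ 2)) := by
    gcongr; exact (hVbd 0 le_rfl).2
  have hc4 : 0 < c / 4 := by positivity
  have : x T ^ 2 + x' T ^ 2
      ≤ (Real.exp (-lam * T) * ((b + K) * (x 0 ^ 2 + x' 0 ^ 2)) + Γ * U / lam) / (c / 4) := by
    rw [le_div_iff₀ hc4]
    linarith
  refine this.trans_eq ?_
  ring

/-- A real function bounded above and nonnegative is bounded by its supremum over a set. -/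
lemma le_biSup_of_nonneg {f : ℝ → ℝ} {S : Set ℝ} {C : ℝ} (h0 : ∀ s, 0 ≤ f s)
    (hC : ∀ s, f s ≤ C) {s : ℝ} (hs : s ∈ S) : f s ≤ ⨆ r ∈ S, f r := by
  have hbdd : BddAbove (range fun r => ⨆ _ : r ∈ S, f r) := by
    refine ⟨C, ?_⟩
    rintro _ ⟨r, rfl⟩
    exact Real.iSup_le (fun _ => hC r) ((h0 r).trans (hC r))
  have h := le_ciSup hbdd s
  have hval : (⨆ _ : s ∈ S, f s) = f s := by
    have : Nonempty (s ∈ S) := ⟨hs⟩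
    exact ciSup_const
  exact hval.symm.trans_le h

/-- Input-to-state stability of the time-varying admittance system. -/
theorem admittance_ISS
    (Mq Mh Kb KL Lmin Lmax VL : ℝ)
    (hMq : 0 < Mq) (hMh : 0 < Mh) (hKb : 0 < Kb) (hKL : 0 < KL)
    (hLmin : 0 < Lmin) (hLmax : 0 < Lmax) (hVL : 0 < VL) (hLle : Lmin ≤ Lmax)
    (L : ℝ → ℝ) (hL : ContDiff ℝ 1 L)
    (hLbd : ∀ t ≥ (0:ℝ), Lmin ≤ L t ∧ L t ≤ Lmax ∧ |deriv L t| ≤ VL)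
    (hgap : 2 * Mq * Mh * Lmax * VL
        < 4 * Real.sqrt (min (Mq * Mh * Lmin ^ 2) Mh * min Kb KL)) :
    ∃ c₁ c₂ lam Γ : ℝ, 0 < c₁ ∧ c₁ ≤ c₂ ∧ 0 < lam ∧ 0 < Γ ∧
      ∀ u₁ u₂ : ℝ → ℝ, Continuous u₁ → Continuous u₂ →
        (∃ Cu : ℝ, ∀ t : ℝ, |u₁ t| ≤ Cu ∧ |u₂ t| ≤ Cu) →
        ∀ ζ₁ ζ₂ : ℝ → ℝ, ContDiff ℝ 2 ζ₁ → ContDiff ℝ 2 ζ₂ →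
          (∀ t ≥ (0:ℝ),
            (Mq * Mh * (L t) ^ 2) * deriv (deriv ζ₁) t
              + 2 * Real.sqrt (Kb * (Mq * Mh * (L t) ^ 2)) * deriv ζ₁ t
              + Kb * ζ₁ t = u₁ t ∧
            Mh * deriv (deriv ζ₂) t
              + 2 * Real.sqrt (KL * Mh) * deriv ζ₂ t
              + KL * ζ₂ t = u₂ t) →
          ∀ t ≥ (0:ℝ),
            ζ₁ t ^ 2 + ζ₂ t ^ 2 + (deriv ζ₁ t) ^ 2 + (deriv ζ₂ t) ^ 2
              ≤ (c₂ / c₁) * Real.exp (-lam * t)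
                  * (ζ₁ 0 ^ 2 + ζ₂ 0 ^ 2 + (deriv ζ₁ 0) ^ 2 + (deriv ζ₂ 0) ^ 2)
                + (Γ / (lam * c₁))
                  * ⨆ s ∈ Icc (0:ℝ) t, (u₁ s ^ 2 + u₂ s ^ 2) := by
  set D := 2 * Mq * Mh * Lmax * VL with hDdef
  set R := Real.sqrt (min (Mq * Mh * Lmin ^ 2) Mh * min Kb KL) with hR
  have hD : 0 ≤ D := by positivity
  obtain ⟨C₁, lam₁, G₁, hC₁, hlam₁, hG₁, H₁⟩ := scalar_admittance_iss (K := Kb)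
    (a := Mq * Mh * Lmin ^ 2) (b := Mq * Mh * Lmax ^ 2) (D := D) (δ := 2 * R - D / 2)
    (E := 2 * Real.sqrt (Kb * (Mq * Mh * Lmax ^ 2))) hKb (by positivity) (by gcongr) hD
    (by linarith) (by positivity)
  have hd₂ : 0 < 2 * Real.sqrt (KL * Mh) := by positivity
  obtain ⟨C₂, lam₂, G₂, hC₂, hlam₂, hG₂, H₂⟩ := scalar_admittance_iss (K := KL)
    (a := Mh) (b := Mh) (D := 0) (δ := 2 * Real.sqrt (KL * Mh))
    (E := 2 * Real.sqrt (KL * Mh)) hKL hMh le_rfl le_rfl hd₂ hd₂.le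
  have hlam : 0 < min lam₁ lam₂ := lt_min hlam₁ hlam₂
  refine ⟨1, 1 + C₁ + C₂, min lam₁ lam₂, min lam₁ lam₂ * (G₁ + G₂), one_pos, by linarith,
    hlam, by positivity, ?_⟩
  intro u₁ u₂ hu₁ hu₂ hCu ζ₁ ζ₂ hζ₁ hζ₂ hode t ht
  obtain ⟨Cu, hCu⟩ := hCu
  set U := ⨆ s ∈ Icc (0:ℝ) t, (u₁ s ^ 2 + u₂ s ^ 2) with hUdef
  have hU : ∀ s ∈ Icc (0:ℝ) t, u₁ s ^ 2 + u₂ s ^ 2 ≤ U := by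
    intro s hs
    refine le_biSup_of_nonneg (f := fun s => u₁ s ^ 2 + u₂ s ^ 2) (C := Cu ^ 2 + Cu ^ 2)
      (fun s => by positivity) (fun s => ?_) hs
    exact add_le_add (sq_le_sq.2 ((hCu s).1.trans (le_abs_self _)))
      (sq_le_sq.2 ((hCu s).2.trans (le_abs_self _)))
  have hderiv : ∀ {ζ : ℝ → ℝ}, ContDiff ℝ 2 ζ →
      (∀ s, HasDerivAt ζ (deriv ζ s) s) ∧ ∀ s, HasDerivAt (deriv ζ) (deriv (deriv ζ) s) s := by
    intro ζ hζ
    refine ⟨fun s => (hζ.differentiable (by norm_num) s).hasDerivAt, fun s => ?_⟩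
    have h1 : ContDiff ℝ 1 (deriv ζ) := (contDiff_succ_iff_deriv.1 hζ).2.2
    exact (h1.differentiable (by norm_num) s).hasDerivAt
  have hLd : ∀ s, HasDerivAt L (deriv L s) s := fun s =>
    (hL.differentiable (by norm_num) s).hasDerivAt
  have b₁ := H₁ (fun s => Mq * Mh * L s ^ 2) (fun s => 2 * Mq * Mh * L s * deriv L s)
    (fun s => 2 * Real.sqrt (Kb * (Mq * Mh * L s ^ 2))) u₁ ζ₁ (deriv ζ₁) (deriv (deriv ζ₁))
    (fun s => by
      refine (((hLd s).pow 2).const_mul (Mq * Mh)).congr_deriv ?_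
      push_cast
      ring)
    (fun s hs => by
      obtain ⟨l1, l2, l3⟩ := hLbd s hs
      have l0 : 0 < L s := hLmin.trans_le l1
      refine ⟨by gcongr, by gcongr, ?_, ?_, by gcongr⟩
      · rw [abs_mul, abs_of_pos (by positivity : 0 < 2 * Mq * Mh * L s), hDdef]
        gcongr
      · have : R ≤ Real.sqrt (Kb * (Mq * Mh * L s ^ 2)) := by
          rw [hR, mul_comm Kb]
          apply Real.sqrt_le_sqrt
          have : min (Mq * Mh * Lmin ^ 2) Mh ≤ Mq * Mh * L s ^ 2 :=
            (min_le_left _ _).trans (by gcongr)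
          exact mul_le_mul this (min_le_left _ _) (lt_min hKb hKL).le (by positivity)
        linarith)
    (hderiv hζ₁).1 (hderiv hζ₁).2 (fun s hs => (hode s hs).1) t ht U
    (fun s hs => by linarith [hU s hs, sq_nonneg (u₂ s)])
  have b₂ := H₂ (fun _ => Mh) (fun _ => 0) (fun _ => 2 * Real.sqrt (KL * Mh)) u₂ ζ₂ (deriv ζ₂)
    (deriv (deriv ζ₂)) (fun s => hasDerivAt_const s Mh) (fun s _ => by simp)
    (hderiv hζ₂).1 (hderiv hζ₂).2 (fun s hs => (hode s hs).2) t ht U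
    (fun s hs => by linarith [hU s hs, sq_nonneg (u₁ s)])
  have e₁ : C₁ * Real.exp (-lam₁ * t) * (ζ₁ 0 ^ 2 + deriv ζ₁ 0 ^ 2)
      ≤ (1 + C₁ + C₂) * Real.exp (-min lam₁ lam₂ * t) * (ζ₁ 0 ^ 2 + deriv ζ₁ 0 ^ 2) := by
    gcongr
    · linarith
    · exact min_le_left _ _
  have e₂ : C₂ * Real.exp (-lam₂ * t) * (ζ₂ 0 ^ 2 + deriv ζ₂ 0 ^ 2)
      ≤ (1 + C₁ + C₂) * Real.exp (-min lam₁ lam₂ * t) * (ζ₂ 0 ^ 2 + deriv ζ₂ 0 ^ 2) := by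
    gcongr
    · linarith
    · exact min_le_right _ _
  rw [mul_one, mul_div_cancel_left₀ _ hlam.ne', div_one]
  linarith
end

section
/- Assume ṁ_max < 4·√(m_min·k_min). Then there exist positive constants c₁ ≤ c₂ and λ₂ such that for every T_c ≥ 0, every continuous input u : ℝ → ℝ² with u(t) = 0 for all t ≥ T_c, and every solution ζ of the admittance dynamics with input u, the extended state satisfies, for all t ≥ T_c: ‖z(t)‖² ≤ (c₂/c₁)·e^{−λ₂·(t−T_c)}·‖z(T_c)‖² (exponential stability of the admittance system once the interaction force vanishes). -/
open Real Set

/-- A nonnegative energy controlling a quantity `q` from both sides and dissipating at rate `lam`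
forces `q` to decay exponentially. -/
theorem le_mul_exp_of_hasDerivAt_le_neg_mul {V V' q : ℝ → ℝ} {a b c lam : ℝ} (ha : 0 < a)
    (hV : ∀ t ≥ c, HasDerivAt V (V' t) t) (hV' : ∀ t ≥ c, V' t ≤ -lam * V t)
    (hlow : ∀ t ≥ c, a * q t ≤ V t) (hup : V c ≤ b * q c) {t : ℝ} (ht : c ≤ t) :
    q t ≤ b / a * Real.exp (-lam * (t - c)) * q c := by
  have hW : ∀ s ≥ c, HasDerivAt (fun s => V s * Real.exp (lam * (s - c)))
      (V' s * Real.exp (lam * (s - c)) + V s * (Real.exp (lam * (s - c)) * lam)) s := by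
    intro s hs
    have h : HasDerivAt (fun s => lam * (s - c)) lam s := by
      simpa using ((hasDerivAt_id s).sub_const c).const_mul lam
    exact (hV s hs).mul h.exp
  have hanti : AntitoneOn (fun s => V s * Real.exp (lam * (s - c))) (Ici c) := by
    refine antitoneOn_of_deriv_nonpos (convex_Ici c)
      (fun s hs => (hW s hs).continuousAt.continuousWithinAt)
      (fun s hs => (hW s (interior_subset hs)).differentiableAt.differentiableWithinAt) ?_
    intro s hs
    have hs' : c ≤ s := interior_subset hs
    rw [(hW s hs').deriv]
    nlinarith [hV' s hs', Real.exp_pos (lam * (s - c))]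
  have h := hanti (mem_Ici.2 le_rfl) (mem_Ici.2 ht) ht
  simp only [sub_self, mul_zero, Real.exp_zero, mul_one] at h
  have hexp : Real.exp (lam * (t - c)) * Real.exp (-lam * (t - c)) = 1 := by
    rw [← Real.exp_add]; simp
  have hVt : V t ≤ V c * Real.exp (-lam * (t - c)) := by
    have := mul_le_mul_of_nonneg_right h (Real.exp_pos (-lam * (t - c))).le
    rwa [mul_assoc, hexp, mul_one] at this
  have hfin : a * q t ≤ b * q c * Real.exp (-lam * (t - c)) :=
    (hlow t ht).trans (hVt.trans (mul_le_mul_of_nonneg_right hup (Real.exp_pos _).le))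
  calc q t = a * q t / a := by field_simp
    _ ≤ b * q c * Real.exp (-lam * (t - c)) / a := by gcongr
    _ = _ := by ring

/-- The cross term `ε * m * x * v` is dominated by half of the mechanical energy. -/
theorem abs_cross_term_le {k m M ε x v : ℝ} (hm : 0 < m) (hmM : m ≤ M) (hε0 : 0 ≤ ε)
    (hε1 : ε ≤ 1) (hεM : ε * M ≤ k / 4) :
    |ε * m * x * v| ≤ m * v ^ 2 / 4 + k * x ^ 2 / 4 := by
  have h1 : ε ^ 2 * m ≤ k / 4 := by
    have h2 : ε * (ε * m) ≤ 1 * (ε * m) := mul_le_mul_of_nonneg_right hε1 (by positivity)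
    have h3 : ε * m ≤ ε * M := mul_le_mul_of_nonneg_left hmM hε0
    nlinarith
  have h4 := mul_le_mul_of_nonneg_right h1 (sq_nonneg x)
  rw [abs_le]
  constructor
  · nlinarith [mul_nonneg hm.le (sq_nonneg (v / 2 + ε * x))]
  · nlinarith [mul_nonneg hm.le (sq_nonneg (v / 2 - ε * x))]

/-- Dissipation of the modified energy of an oscillator `m v' + d v + k x = 0`, where `m'` is
the rate of change of the mass. -/
theorem modified_energy_dissipation {k m m' M d δ B D ε x v : ℝ} (hk : 0 < k) (hε : 0 < ε)
    (hmM : m ≤ M) (hm' : |m'| ≤ B) (hd : δ + B / 2 ≤ d) (hdD : |d| ≤ D)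
    (hεδ : ε * (M + (B + D) ^ 2 / (2 * k)) ≤ δ / 2) :
    m' * v ^ 2 / 2 - d * v ^ 2 + ε * (m' * x * v + m * v ^ 2 - d * x * v - k * x ^ 2)
      ≤ -(δ / 2 * v ^ 2 + ε * k / 2 * x ^ 2) := by
  have hC : (m' - d) ^ 2 ≤ (B + D) ^ 2 :=
    sq_le_sq' (by linarith [neg_abs_le m', le_abs_self d])
      (by linarith [le_abs_self m', neg_abs_le d])
  have hcross : (m' - d) * x * v ≤ k / 2 * x ^ 2 + (B + D) ^ 2 / (2 * k) * v ^ 2 := by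
    have h1 : (m' - d) * x * v ≤ k / 2 * x ^ 2 + (m' - d) ^ 2 / (2 * k) * v ^ 2 := by
      have h2 : k / 2 * x ^ 2 + (m' - d) ^ 2 / (2 * k) * v ^ 2 - (m' - d) * x * v
          = (k * x - (m' - d) * v) ^ 2 / (2 * k) := by
        field_simp; ring
      have h3 : 0 ≤ (k * x - (m' - d) * v) ^ 2 / (2 * k) := by positivity
      linarith
    have h4 : (m' - d) ^ 2 / (2 * k) * v ^ 2 ≤ (B + D) ^ 2 / (2 * k) * v ^ 2 := by gcongr
    linarith
  have h5 := mul_le_mul_of_nonneg_left hcross hε.le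
  have h6 := mul_le_mul_of_nonneg_right hεδ (sq_nonneg v)
  have h7 : ε * (m * v ^ 2) ≤ ε * (M * v ^ 2) := by gcongr
  have h8 : (m' / 2 - d + δ) * v ^ 2 ≤ 0 :=
    mul_nonpos_of_nonpos_of_nonneg (by linarith [le_abs_self m']) (sq_nonneg v)
  linarith

/-- Uniform exponential stability of a scalar oscillator with time-varying mass whose damping
dominates half of the rate of change of the mass. -/
theorem exists_exponential_decay_of_damped_oscillator {k μ M B D δ : ℝ} (hk : 0 < k) (hμ : 0 < μ)
    (hμM : μ ≤ M) (hδ : 0 < δ) :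
    ∃ C lam : ℝ, 1 ≤ C ∧ 0 < lam ∧ ∀ (c : ℝ) (m m' d x : ℝ → ℝ), ContDiff ℝ 2 x →
      (∀ t ≥ c, HasDerivAt m (m' t) t ∧ μ ≤ m t ∧ m t ≤ M ∧ |m' t| ≤ B ∧
        δ + B / 2 ≤ d t ∧ |d t| ≤ D ∧ m t * deriv (deriv x) t + d t * deriv x t + k * x t = 0) →
      ∀ t ≥ c, x t ^ 2 + deriv x t ^ 2
        ≤ C * Real.exp (-lam * (t - c)) * (x c ^ 2 + deriv x c ^ 2) := by
  have hM : 0 < M := hμ.trans_le hμM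
  have hden : 0 < M + (B + D) ^ 2 / (2 * k) := by positivity
  obtain ⟨ε, hε, hε1, hεM, hεδ⟩ : ∃ ε : ℝ, 0 < ε ∧ ε ≤ 1 ∧ ε * M ≤ k / 4 ∧
      ε * (M + (B + D) ^ 2 / (2 * k)) ≤ δ / 2 := by
    refine ⟨min 1 (min (k / 4 / M) (δ / 2 / (M + (B + D) ^ 2 / (2 * k)))),
      lt_min one_pos (lt_min (by positivity) (by positivity)), min_le_left _ _, ?_, ?_⟩
    · exact (le_div_iff₀ hM).1 ((min_le_right _ _).trans (min_le_left _ _))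
    · exact (le_div_iff₀ hden).1 ((min_le_right _ _).trans (min_le_right _ _))
  obtain ⟨lam, hlam, hlamM, hlamε⟩ : ∃ lam : ℝ, 0 < lam ∧ lam * M ≤ 2 * δ / 3 ∧
      lam ≤ 2 * ε / 3 :=
    ⟨min (2 * δ / 3 / M) (2 * ε / 3), lt_min (by positivity) (by positivity),
      (le_div_iff₀ hM).1 (min_le_left _ _), min_le_right _ _⟩
  have ha : 0 < min μ k / 4 := by have := lt_min hμ hk; positivity
  refine ⟨(3 * max M k / 4) / (min μ k / 4), lam, ?_, hlam, ?_⟩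
  · rw [one_le_div ha]
    linarith [min_le_right μ k, le_max_right M k]
  intro c m m' d x hx h t ht
  have hx1 : ∀ s, HasDerivAt x (deriv x s) s := fun s =>
    (hx.differentiable (by norm_num) s).hasDerivAt
  have hx2 : ∀ s, HasDerivAt (deriv x) (deriv (deriv x) s) s := fun s =>
    ((hx.iterate_deriv' 1 1).differentiable (by norm_num) s).hasDerivAt
  have hcross : ∀ s ≥ c, |ε * m s * x s * deriv x s|
      ≤ m s * deriv x s ^ 2 / 4 + k * x s ^ 2 / 4 := fun s hs =>
    abs_cross_term_le (hμ.trans_le (h s hs).2.1) (h s hs).2.2.1 hε.le hε1 hεM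
  refine le_mul_exp_of_hasDerivAt_le_neg_mul
    (V := fun s => m s * deriv x s ^ 2 / 2 + k * x s ^ 2 / 2 + ε * m s * x s * deriv x s)
    (V' := fun s => m' s * deriv x s ^ 2 / 2 - d s * deriv x s ^ 2
      + ε * (m' s * x s * deriv x s + m s * deriv x s ^ 2 - d s * x s * deriv x s - k * x s ^ 2))
    (q := fun s => x s ^ 2 + deriv x s ^ 2) ha ?_ ?_ ?_ ?_ ht
  · intro s hs
    obtain ⟨hm, -, -, -, -, -, hode⟩ := h s hs
    have hder := (((hm.mul ((hx2 s).pow 2)).div_const 2).add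
      ((((hx1 s).pow 2).const_mul k).div_const 2)).add
      (((hm.const_mul ε).mul (hx1 s)).mul (hx2 s))
    refine hder.congr_deriv ?_
    simp only [Pi.mul_apply, Pi.pow_apply]
    push_cast
    linear_combination (deriv x s + ε * x s) * hode
  · intro s hs
    obtain ⟨-, -, hmM, hm', hd, hdD, -⟩ := h s hs
    have hdis := modified_energy_dissipation (x := x s) (v := deriv x s) hk hε hmM hm' hd hdD hεδ
    have hc := (abs_le.1 (hcross s hs)).2
    have h1 : m s * deriv x s ^ 2 ≤ M * deriv x s ^ 2 := by gcongr
    have h2 : m s * deriv x s ^ 2 / 2 + k * x s ^ 2 / 2 + ε * m s * x s * deriv x s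
        ≤ 3 / 4 * (M * deriv x s ^ 2 + k * x s ^ 2) := by linarith
    have h3 := mul_le_mul_of_nonneg_left h2 hlam.le
    have h4 := mul_le_mul_of_nonneg_right hlamM (sq_nonneg (deriv x s))
    have h5 := mul_le_mul_of_nonneg_right hlamε (mul_nonneg hk.le (sq_nonneg (x s)))
    linarith
  · intro s hs
    obtain ⟨-, hμm, -⟩ := h s hs
    have hc := (abs_le.1 (hcross s hs)).1
    have h1 : min μ k * deriv x s ^ 2 ≤ m s * deriv x s ^ 2 :=
      mul_le_mul_of_nonneg_right ((min_le_left _ _).trans hμm) (sq_nonneg _)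
    have h2 : min μ k * x s ^ 2 ≤ k * x s ^ 2 :=
      mul_le_mul_of_nonneg_right (min_le_right _ _) (sq_nonneg _)
    linarith
  · obtain ⟨-, -, hmM, -⟩ := h c le_rfl
    have hc := (abs_le.1 (hcross c le_rfl)).2
    have h1 : m c * deriv x c ^ 2 ≤ max M k * deriv x c ^ 2 :=
      mul_le_mul_of_nonneg_right (hmM.trans (le_max_left _ _)) (sq_nonneg _)
    have h2 : k * x c ^ 2 ≤ max M k * x c ^ 2 :=
      mul_le_mul_of_nonneg_right (le_max_right _ _) (sq_nonneg _)
    linarith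

/-- Exponential stability of the admittance system once the
interaction force vanishes. -/
theorem admittance_exponential_stability
    (Mq Mh Kb KL Lmin Lmax VL : ℝ)
    (hMq : 0 < Mq) (hMh : 0 < Mh) (hKb : 0 < Kb) (hKL : 0 < KL)
    (hLmin : 0 < Lmin) (hLmax : 0 < Lmax) (hVL : 0 < VL) (hLle : Lmin ≤ Lmax)
    (L : ℝ → ℝ) (hL : ContDiff ℝ 1 L)
    (hLbd : ∀ t ≥ (0:ℝ), Lmin ≤ L t ∧ L t ≤ Lmax ∧ |deriv L t| ≤ VL)
    (hgap : 2 * Mq * Mh * Lmax * VL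
        < 4 * Real.sqrt (min (Mq * Mh * Lmin ^ 2) Mh * min Kb KL)) :
    ∃ c₁ c₂ lam : ℝ, 0 < c₁ ∧ c₁ ≤ c₂ ∧ 0 < lam ∧
      ∀ Tc : ℝ, 0 ≤ Tc →
        ∀ u₁ u₂ : ℝ → ℝ, Continuous u₁ → Continuous u₂ →
          (∀ t ≥ Tc, u₁ t = 0 ∧ u₂ t = 0) →
          ∀ ζ₁ ζ₂ : ℝ → ℝ, ContDiff ℝ 2 ζ₁ → ContDiff ℝ 2 ζ₂ →
            (∀ t ≥ (0:ℝ),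
              (Mq * Mh * (L t) ^ 2) * deriv (deriv ζ₁) t
                + 2 * Real.sqrt (Kb * (Mq * Mh * (L t) ^ 2)) * deriv ζ₁ t
                + Kb * ζ₁ t = u₁ t ∧
              Mh * deriv (deriv ζ₂) t
                + 2 * Real.sqrt (KL * Mh) * deriv ζ₂ t
                + KL * ζ₂ t = u₂ t) →
            ∀ t ≥ Tc,
              ζ₁ t ^ 2 + ζ₂ t ^ 2 + (deriv ζ₁ t) ^ 2 + (deriv ζ₂ t) ^ 2
                ≤ (c₂ / c₁) * Real.exp (-lam * (t - Tc))
                    * (ζ₁ Tc ^ 2 + ζ₂ Tc ^ 2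
                        + (deriv ζ₁ Tc) ^ 2 + (deriv ζ₂ Tc) ^ 2) := by
  set B := 2 * Mq * Mh * Lmax * VL with hB
  set r := Real.sqrt (min (Mq * Mh * Lmin ^ 2) Mh * min Kb KL) with hr
  have hmass : ∀ s ≥ (0 : ℝ), Mq * Mh * Lmin ^ 2 ≤ Mq * Mh * L s ^ 2 ∧
      Mq * Mh * L s ^ 2 ≤ Mq * Mh * Lmax ^ 2 := by
    intro s hs
    obtain ⟨h1, h2, -⟩ := hLbd s hs
    have h3 : 0 ≤ L s := hLmin.le.trans h1
    constructor <;> gcongr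
  obtain ⟨C₁, lam₁, hC₁, hlam₁, hdecay₁⟩ :=
    exists_exponential_decay_of_damped_oscillator (k := Kb) (μ := Mq * Mh * Lmin ^ 2)
      (M := Mq * Mh * Lmax ^ 2) (B := B) (D := 2 * Real.sqrt (Kb * (Mq * Mh * Lmax ^ 2)))
      (δ := 2 * r - B / 2) hKb (by positivity) (by gcongr) (by linarith)
  have hd₂ : 0 < 2 * Real.sqrt (KL * Mh) := by positivity
  obtain ⟨C₂, lam₂, hC₂, hlam₂, hdecay₂⟩ :=
    exists_exponential_decay_of_damped_oscillator (k := KL) (μ := Mh)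
      (M := Mh) (B := 0) (D := 2 * Real.sqrt (KL * Mh)) hKL hMh le_rfl hd₂
  refine ⟨1, max C₁ C₂, min lam₁ lam₂, one_pos, hC₁.trans (le_max_left _ _),
    lt_min hlam₁ hlam₂, ?_⟩
  intro Tc hTc u₁ u₂ _ _ hu ζ₁ ζ₂ hζ₁ hζ₂ hode t ht
  have h₁ := hdecay₁ Tc (fun s => Mq * Mh * L s ^ 2) (fun s => Mq * Mh * (2 * L s * deriv L s))
    (fun s => 2 * Real.sqrt (Kb * (Mq * Mh * L s ^ 2))) ζ₁ hζ₁ (by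
      intro s hs
      have hs0 : 0 ≤ s := hTc.trans hs
      obtain ⟨hL1, hL2, hL3⟩ := hLbd s hs0
      have hL0 : 0 < L s := hLmin.trans_le hL1
      refine ⟨?_, (hmass s hs0).1, (hmass s hs0).2, ?_, ?_, ?_, ?_⟩
      · have hLs := (hL.differentiable (by norm_num) s).hasDerivAt
        exact ((hLs.pow 2).const_mul (Mq * Mh)).congr_deriv (by norm_num)
      · rw [show Mq * Mh * (2 * L s * deriv L s) = 2 * Mq * Mh * L s * deriv L s by ring,
          abs_mul, abs_of_pos (by positivity : 0 < 2 * Mq * Mh * L s), hB]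
        gcongr
      · have : r ≤ Real.sqrt (Kb * (Mq * Mh * L s ^ 2)) := by
          refine Real.sqrt_le_sqrt ?_
          rw [mul_comm]
          exact mul_le_mul (min_le_left _ _) ((min_le_left _ _).trans (hmass s hs0).1)
            (le_min (by positivity) hMh.le) hKb.le
        linarith
      · rw [abs_of_nonneg (by positivity)]
        have := (hmass s hs0).2
        gcongr
      · rw [(hode s hs0).1, (hu s hs).1]) t ht
  have h₂ := hdecay₂ Tc (fun _ => Mh) (fun _ => 0) (fun _ => 2 * Real.sqrt (KL * Mh)) ζ₂ hζ₂ (by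
      intro s hs
      refine ⟨hasDerivAt_const s Mh, le_rfl, le_rfl, by simp, by simp, (abs_of_pos hd₂).le, ?_⟩
      rw [(hode s (hTc.trans hs)).2, (hu s hs).2]) t ht
  have ht0 : 0 ≤ t - Tc := sub_nonneg.2 ht
  have hmono₁ : C₁ * Real.exp (-lam₁ * (t - Tc))
      ≤ max C₁ C₂ * Real.exp (-min lam₁ lam₂ * (t - Tc)) := by
    gcongr
    · exact le_max_left _ _
    · exact min_le_left _ _
  have hmono₂ : C₂ * Real.exp (-lam₂ * (t - Tc))
      ≤ max C₁ C₂ * Real.exp (-min lam₁ lam₂ * (t - Tc)) := by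
    gcongr
    · exact le_max_right _ _
    · exact min_le_right _ _
  have h₁' := h₁.trans (mul_le_mul_of_nonneg_right hmono₁ (by positivity))
  have h₂' := h₂.trans (mul_le_mul_of_nonneg_right hmono₂ (by positivity))
  rw [div_one]
  linarith
end

section
/- If 0 < ε < min(√(M_q·M_h·L_min²/K_β), √(M_h/K_L)), then there exist constants 0 < c₁ ≤ c₂ such that for every t ≥ 0 and every (a₁, a₂, b₁, b₂) ∈ ℝ⁴: c₁·(a₁² + a₂² + b₁² + b₂²) ≤ ½·K_β·a₁² + ½·m₁(t)·b₁² + ε·K_β·a₁·b₁ + ½·K_L·a₂² + ½·M_h·b₂² + ε·K_L·a₂·b₂ ≤ c₂·(a₁² + a₂² + b₁² + b₂²) (uniform quadratic sandwich bounds for the Lyapunov function of the time-varying admittance system). -/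
open Real

/-- A binary quadratic form with positive diagonal and positive determinant is coercive, uniformly
in the second diagonal entry once the latter is bounded below. -/
theorem exists_pos_mul_sq_add_sq_le {k m d : ℝ} (hk : 0 < k) (hm : 0 < m) (hd : d ^ 2 < k * m) :
    ∃ c : ℝ, 0 < c ∧ ∀ m' ≥ m, ∀ a b : ℝ,
      c * (a ^ 2 + b ^ 2) ≤ 1 / 2 * k * a ^ 2 + 1 / 2 * m' * b ^ 2 + d * a * b := by
  obtain ⟨e, he⟩ : ∃ e, e = (k * m - d ^ 2) / (k + m) := ⟨_, rfl⟩
  have hkm : 0 < k + m := by positivity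
  have he0 : 0 < e := he ▸ div_pos (by linarith) hkm
  have hemul : e * (k + m) = k * m - d ^ 2 := by rw [he]; field_simp
  have hek : 0 < k - e := by
    have : e < k := he ▸ (div_lt_iff₀ hkm).2 (by nlinarith [sq_nonneg d, mul_pos hk hk])
    linarith
  refine ⟨e / 2, by positivity, fun m' hm' a b => ?_⟩
  have hdet : (k - e) * (m - e) - d ^ 2 = e ^ 2 := by linear_combination -hemul
  have hprod : (k - e) * ((k - e) * a ^ 2 + 2 * d * a * b + (m - e) * b ^ 2)
      = ((k - e) * a + d * b) ^ 2 + e ^ 2 * b ^ 2 := by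
    linear_combination b ^ 2 * hdet
  have hform : 0 ≤ (k - e) * a ^ 2 + 2 * d * a * b + (m - e) * b ^ 2 :=
    nonneg_of_mul_nonneg_right (hprod ▸ by positivity) hek
  linarith [mul_le_mul_of_nonneg_right hm' (sq_nonneg b)]

/-- A binary quadratic form is bounded above by a multiple of `a ^ 2 + b ^ 2`. -/
theorem quadratic_le_mul_sq_add_sq {k m M d : ℝ} (hk : 0 ≤ k) (hM : 0 ≤ M) (hd : 0 ≤ d)
    (hmM : m ≤ M) (a b : ℝ) :
    1 / 2 * k * a ^ 2 + 1 / 2 * m * b ^ 2 + d * a * b ≤ (k + M + d) * (a ^ 2 + b ^ 2) := by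
  have hdab := mul_nonneg hd (sq_nonneg (a - b))
  have hm := mul_le_mul_of_nonneg_right hmM (sq_nonneg b)
  have hka := mul_nonneg hk (sq_nonneg a)
  have hkb := mul_nonneg hk (sq_nonneg b)
  have hMa := mul_nonneg hM (sq_nonneg a)
  have hMb := mul_nonneg hM (sq_nonneg b)
  have hda := mul_nonneg hd (sq_nonneg a)
  have hdb := mul_nonneg hd (sq_nonneg b)
  linarith

/-- The smallness condition `ε < √(m / k)` makes the determinant of the form positive. -/
theorem mul_sq_lt_mul_of_lt_sqrt_div {k m ε : ℝ} (hk : 0 < k) (hε : 0 ≤ ε)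
    (h : ε < Real.sqrt (m / k)) : (ε * k) ^ 2 < k * m := by
  have h₁ : ε ^ 2 * k < m := (lt_div_iff₀ hk).1 ((Real.lt_sqrt hε).1 h)
  linarith [mul_lt_mul_of_pos_left h₁ hk]

/-- uniform quadratic sandwich bounds for the Lyapunov function
of the time-varying admittance system. -/
theorem lyapunov_quadratic_bounds
    (Mq Mh Kb KL Lmin Lmax VL : ℝ)
    (hMq : 0 < Mq) (hMh : 0 < Mh) (hKb : 0 < Kb) (hKL : 0 < KL)
    (hLmin : 0 < Lmin) (hLmax : 0 < Lmax) (hVL : 0 < VL) (hLle : Lmin ≤ Lmax)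
    (L : ℝ → ℝ) (hL : ContDiff ℝ 1 L)
    (hLbd : ∀ t ≥ (0:ℝ), Lmin ≤ L t ∧ L t ≤ Lmax ∧ |deriv L t| ≤ VL)
    (ε : ℝ) (hε : 0 < ε)
    (hεlt : ε < min (Real.sqrt (Mq * Mh * Lmin ^ 2 / Kb)) (Real.sqrt (Mh / KL))) :
    ∃ c₁ c₂ : ℝ, 0 < c₁ ∧ c₁ ≤ c₂ ∧
      ∀ t ≥ (0:ℝ), ∀ a₁ a₂ b₁ b₂ : ℝ,
        c₁ * (a₁ ^ 2 + a₂ ^ 2 + b₁ ^ 2 + b₂ ^ 2)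
          ≤ 1/2 * Kb * a₁ ^ 2 + 1/2 * (Mq * Mh * (L t) ^ 2) * b₁ ^ 2
              + ε * Kb * a₁ * b₁
              + 1/2 * KL * a₂ ^ 2 + 1/2 * Mh * b₂ ^ 2 + ε * KL * a₂ * b₂ ∧
        1/2 * Kb * a₁ ^ 2 + 1/2 * (Mq * Mh * (L t) ^ 2) * b₁ ^ 2
              + ε * Kb * a₁ * b₁
              + 1/2 * KL * a₂ ^ 2 + 1/2 * Mh * b₂ ^ 2 + ε * KL * a₂ * b₂
          ≤ c₂ * (a₁ ^ 2 + a₂ ^ 2 + b₁ ^ 2 + b₂ ^ 2) := by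
  obtain ⟨hε₁, hε₂⟩ := lt_min_iff.1 hεlt
  obtain ⟨c, hc, hcle⟩ := exists_pos_mul_sq_add_sq_le hKb (by positivity)
    (mul_sq_lt_mul_of_lt_sqrt_div hKb hε.le hε₁)
  obtain ⟨c', hc', hcle'⟩ := exists_pos_mul_sq_add_sq_le hKL hMh
    (mul_sq_lt_mul_of_lt_sqrt_div hKL hε.le hε₂)
  obtain ⟨C, hC⟩ : ∃ C, C = Kb + Mq * Mh * Lmax ^ 2 + ε * Kb := ⟨_, rfl⟩
  obtain ⟨C', hC'⟩ : ∃ C', C' = KL + Mh + ε * KL := ⟨_, rfl⟩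
  have hC0 : 0 < C := hC ▸ by positivity
  have hC0' : 0 < C' := hC' ▸ by positivity
  refine ⟨min c c', C + C' + min c c', lt_min hc hc', by linarith, fun t ht a₁ a₂ b₁ b₂ => ?_⟩
  obtain ⟨hLt, hLt', -⟩ := hLbd t ht
  have hLt0 : 0 < L t := hLmin.trans_le hLt
  have hn : 0 ≤ a₁ ^ 2 + b₁ ^ 2 := by positivity
  have hn' : 0 ≤ a₂ ^ 2 + b₂ ^ 2 := by positivity
  constructor
  · have h := hcle (Mq * Mh * L t ^ 2) (by gcongr) a₁ b₁
    have h' := hcle' Mh le_rfl a₂ b₂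
    linarith [mul_le_mul_of_nonneg_right (min_le_left c c') hn,
      mul_le_mul_of_nonneg_right (min_le_right c c') hn']
  · have h := quadratic_le_mul_sq_add_sq (d := ε * Kb) hKb.le
      (by positivity : 0 ≤ Mq * Mh * Lmax ^ 2) (by positivity)
      (by gcongr : Mq * Mh * L t ^ 2 ≤ Mq * Mh * Lmax ^ 2) a₁ b₁
    have h' := quadratic_le_mul_sq_add_sq (d := ε * KL) hKL.le hMh.le (by positivity) le_rfl a₂ b₂
    rw [← hC] at h
    rw [← hC'] at h'
    have hmin := (lt_min hc hc').le
    linarith [mul_nonneg hC0.le hn', mul_nonneg hC0'.le hn, mul_nonneg hmin hn,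
      mul_nonneg hmin hn']
end

section
/- Suppose there exist positive constants ε, η₁, η₂, η₃ such that μ₂ := 2·√(m_min·k_min) − ½·ṁ_max − ε·k_max − ε/(2·η₁) − η₂/2 > 0 and μ₁ := ε·k_min²/m_max − 2·ε·η₁·k_max³/m_min − η₃/2 > 0, and set Γ := 1/(2·η₂) + ε²·k_max²/(2·η₃·m_min²). Then for every continuous input u and every solution ζ of the admittance dynamics with input u, the Lyapunov function V_ε satisfies, for all t ≥ 0: V_ε'(t) ≤ −μ₁·(ζ₁(t)² + ζ₂(t)²) − μ₂·(ζ₁'(t)² + ζ₂'(t)²) + Γ·(u₁(t)² + u₂(t)²). -/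
open Real

/-- Young's inequality with weight `η`. -/
theorem mul_le_weighted_sq_add_sq (a b : ℝ) {η : ℝ} (hη : 0 < η) :
    a * b ≤ η / 2 * a ^ 2 + b ^ 2 / (2 * η) := by
  have h : η / 2 * a ^ 2 + b ^ 2 / (2 * η) - a * b = (η * a - b) ^ 2 / (2 * η) := by
    field_simp
    ring
  have h' : 0 ≤ (η * a - b) ^ 2 / (2 * η) := by positivity
  linarith

/-- Dissipation estimate for one critically damped degree of freedom with position `x`,
velocity `v`, acceleration `a`, input `u`, mass `m` and mass rate `m'`. -/
theorem critically_damped_dissipation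
    {m m' K kmin kmax mmin mmax D ε η₁ η₂ η₃ x v a u : ℝ}
    (hmmin : 0 < mmin) (hm₁ : mmin ≤ m) (hm₂ : m ≤ mmax) (hm' : m' ≤ D)
    (hkmin : 0 < kmin) (hk₁ : kmin ≤ K) (hk₂ : K ≤ kmax)
    (hε : 0 < ε) (hη₁ : 0 < η₁) (hη₂ : 0 < η₂) (hη₃ : 0 < η₃)
    (hode : m * a + 2 * √(K * m) * v + K * x = u) :
    K * x * v + m * v * a + 1 / 2 * m' * v ^ 2 + ε * K * (v ^ 2 + x * a) ≤
      -(ε * kmin ^ 2 / mmax - 2 * ε * η₁ * kmax ^ 3 / mmin - η₃ / 2) * x ^ 2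
        - (2 * √(mmin * kmin) - 1 / 2 * D - ε * kmax - ε / (2 * η₁) - η₂ / 2) * v ^ 2
        + (1 / (2 * η₂) + ε ^ 2 * kmax ^ 2 / (2 * η₃ * mmin ^ 2)) * u ^ 2 := by
  have hkmax : 0 < kmax := hkmin.trans_le (hk₁.trans hk₂)
  have hm : 0 < m := hmmin.trans_le hm₁
  have hK : 0 < K := hkmin.trans_le hk₁
  set s := √(K * m) with hs
  have hs2 : s ^ 2 = K * m := Real.sq_sqrt (by positivity)
  have hsmin : √(mmin * kmin) ≤ s := by
    rw [hs, mul_comm K m]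
    gcongr
  have ha : a = (u - 2 * s * v - K * x) / m := by
    field_simp
    linarith
  have hV : K * x * v + m * v * a + 1 / 2 * m' * v ^ 2 + ε * K * (v ^ 2 + x * a) =
      v * u - 2 * s * v ^ 2 + 1 / 2 * m' * v ^ 2 + ε * K * v ^ 2 - ε * K ^ 2 / m * x ^ 2
        + ε * ((-(2 * K * s / m) * x) * v) + x * (ε * K / m * u) := by
    rw [ha]
    field_simp
    ring
  have hstiff : ε * kmin ^ 2 / mmax * x ^ 2 ≤ ε * K ^ 2 / m * x ^ 2 := by gcongr
  have hdamp : √(mmin * kmin) * v ^ 2 ≤ s * v ^ 2 := by gcongr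
  have hrate : m' * v ^ 2 ≤ D * v ^ 2 := by gcongr
  have hkin : ε * K * v ^ 2 ≤ ε * kmax * v ^ 2 := by gcongr
  have hvu := mul_le_weighted_sq_add_sq v u hη₂
  have hxu := mul_le_weighted_sq_add_sq x (ε * K / m * u) hη₃
  have hxv := mul_le_mul_of_nonneg_left
    (mul_le_weighted_sq_add_sq (-(2 * K * s / m) * x) v hη₁) hε.le
  have hcross : ε * (η₁ / 2 * (-(2 * K * s / m) * x) ^ 2 + v ^ 2 / (2 * η₁)) =
      2 * ε * η₁ * K ^ 3 / m * x ^ 2 + ε / (2 * η₁) * v ^ 2 := by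
    have h : (-(2 * K * s / m) * x) ^ 2 = 4 * K ^ 2 * s ^ 2 / m ^ 2 * x ^ 2 := by ring
    rw [h, hs2]
    field_simp
    ring
  have hcross' : 2 * ε * η₁ * K ^ 3 / m * x ^ 2 ≤ 2 * ε * η₁ * kmax ^ 3 / mmin * x ^ 2 := by
    gcongr
  have hinput : (ε * K / m * u) ^ 2 / (2 * η₃) = ε ^ 2 * K ^ 2 / (2 * η₃ * m ^ 2) * u ^ 2 := by
    field_simp
  have hinput' : ε ^ 2 * K ^ 2 / (2 * η₃ * m ^ 2) * u ^ 2 ≤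
      ε ^ 2 * kmax ^ 2 / (2 * η₃ * mmin ^ 2) * u ^ 2 := by gcongr
  have hu : u ^ 2 / (2 * η₂) = 1 / (2 * η₂) * u ^ 2 := by ring
  rw [hV]
  linarith

/-- dissipation inequality for the Lyapunov function of the
time-varying admittance system, under the Young-inequality gain conditions. -/
theorem lyapunov_dissipation_inequality
    (Mq Mh Kb KL Lmin Lmax VL : ℝ)
    (hMq : 0 < Mq) (hMh : 0 < Mh) (hKb : 0 < Kb) (hKL : 0 < KL)
    (hLmin : 0 < Lmin) (hLmax : 0 < Lmax) (hVL : 0 < VL) (hLle : Lmin ≤ Lmax)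
    (L : ℝ → ℝ) (hL : ContDiff ℝ 1 L)
    (hLbd : ∀ t ≥ (0:ℝ), Lmin ≤ L t ∧ L t ≤ Lmax ∧ |deriv L t| ≤ VL)
    (ε η₁ η₂ η₃ μ₁ μ₂ Γ : ℝ)
    (hε : 0 < ε) (hη₁ : 0 < η₁) (hη₂ : 0 < η₂) (hη₃ : 0 < η₃)
    (hμ₂def : μ₂ = 2 * Real.sqrt (min (Mq * Mh * Lmin ^ 2) Mh * min Kb KL)
        - 1/2 * (2 * Mq * Mh * Lmax * VL) - ε * max Kb KL
        - ε / (2 * η₁) - η₂ / 2)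
    (hμ₂pos : 0 < μ₂)
    (hμ₁def : μ₁ = ε * (min Kb KL) ^ 2 / max (Mq * Mh * Lmax ^ 2) Mh
        - 2 * ε * η₁ * (max Kb KL) ^ 3 / min (Mq * Mh * Lmin ^ 2) Mh
        - η₃ / 2)
    (hμ₁pos : 0 < μ₁)
    (hΓdef : Γ = 1 / (2 * η₂)
        + ε ^ 2 * (max Kb KL) ^ 2 / (2 * η₃ * (min (Mq * Mh * Lmin ^ 2) Mh) ^ 2)) :
    ∀ u₁ u₂ : ℝ → ℝ, Continuous u₁ → Continuous u₂ →
      ∀ ζ₁ ζ₂ : ℝ → ℝ, ContDiff ℝ 2 ζ₁ → ContDiff ℝ 2 ζ₂ →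
        (∀ t ≥ (0:ℝ),
          (Mq * Mh * (L t) ^ 2) * deriv (deriv ζ₁) t
            + 2 * Real.sqrt (Kb * (Mq * Mh * (L t) ^ 2)) * deriv ζ₁ t
            + Kb * ζ₁ t = u₁ t ∧
          Mh * deriv (deriv ζ₂) t
            + 2 * Real.sqrt (KL * Mh) * deriv ζ₂ t
            + KL * ζ₂ t = u₂ t) →
        ∀ t ≥ (0:ℝ),
          deriv (fun s => 1/2 * Kb * ζ₁ s ^ 2
              + 1/2 * (Mq * Mh * (L s) ^ 2) * (deriv ζ₁ s) ^ 2
              + ε * Kb * ζ₁ s * deriv ζ₁ s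
              + 1/2 * KL * ζ₂ s ^ 2 + 1/2 * Mh * (deriv ζ₂ s) ^ 2
              + ε * KL * ζ₂ s * deriv ζ₂ s) t
            ≤ -μ₁ * (ζ₁ t ^ 2 + ζ₂ t ^ 2)
              - μ₂ * ((deriv ζ₁ t) ^ 2 + (deriv ζ₂ t) ^ 2)
              + Γ * (u₁ t ^ 2 + u₂ t ^ 2) := by
  intro u₁ u₂ _ _ ζ₁ ζ₂ hζ₁ hζ₂ hode t ht
  obtain ⟨hL₁, hL₂, hL'⟩ := hLbd t ht
  obtain ⟨hode₁, hode₂⟩ := hode t ht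
  have hLpos : 0 < L t := hLmin.trans_le hL₁
  have dL : HasDerivAt L (deriv L t) t := (hL.differentiable (by norm_num) t).hasDerivAt
  have first {f : ℝ → ℝ} (hf : ContDiff ℝ 2 f) : HasDerivAt f (deriv f t) t :=
    (hf.differentiable (by norm_num) t).hasDerivAt
  have second {f : ℝ → ℝ} (hf : ContDiff ℝ 2 f) :
      HasDerivAt (deriv f) (deriv (deriv f) t) t := by
    have hf' : ContDiff ℝ 1 (deriv f) := hf.deriv' (n := 1)
    exact (hf'.differentiable (by norm_num) t).hasDerivAt
  have hrate : 2 * Mq * Mh * L t * deriv L t ≤ 2 * Mq * Mh * Lmax * VL := by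
    calc 2 * Mq * Mh * L t * deriv L t ≤ 2 * Mq * Mh * L t * VL := by
          gcongr
          exact (le_abs_self _).trans hL'
      _ ≤ 2 * Mq * Mh * Lmax * VL := by gcongr
  have hmmin : 0 < min (Mq * Mh * Lmin ^ 2) Mh := lt_min (by positivity) hMh
  have hkmin : 0 < min Kb KL := lt_min hKb hKL
  have est₁ := critically_damped_dissipation hmmin
    ((min_le_left _ _).trans (by gcongr : Mq * Mh * Lmin ^ 2 ≤ Mq * Mh * L t ^ 2))
    ((by gcongr : Mq * Mh * L t ^ 2 ≤ Mq * Mh * Lmax ^ 2).trans (le_max_left _ Mh))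
    hrate hkmin (min_le_left _ _) (le_max_left Kb KL) hε hη₁ hη₂ hη₃ hode₁
  have est₂ := critically_damped_dissipation hmmin (min_le_right _ _)
    (le_max_right (Mq * Mh * Lmax ^ 2) Mh)
    (by positivity : (0 : ℝ) ≤ 2 * Mq * Mh * Lmax * VL)
    hkmin (min_le_right _ _) (le_max_right Kb KL) hε hη₁ hη₂ hη₃ hode₂
  rw [← hμ₁def, ← hμ₂def, ← hΓdef] at est₁ est₂
  have dV := ((((((first hζ₁).pow 2).const_mul (1/2 * Kb)).add
    ((((dL.pow 2).const_mul (Mq * Mh)).const_mul (1/2)).mul ((second hζ₁).pow 2))).add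
    (((first hζ₁).const_mul (ε * Kb)).mul (second hζ₁))).add
    (((first hζ₂).pow 2).const_mul (1/2 * KL))).add
    (((second hζ₂).pow 2).const_mul (1/2 * Mh)) |>.add
    (((first hζ₂).const_mul (ε * KL)).mul (second hζ₂))
  refine (HasDerivAt.deriv dV).trans_le ?_
  simp only [Pi.pow_apply]
  norm_num
  linarith
end

section
/- Let γ ∈ (0, 1), t₀ ≤ T, let ξ₁ and ξ₂ be real 3×3 matrices, and let f : ℝ → ℝ³ be continuous with ‖f(t)‖ ≤ C for all t ∈ [t₀, T] and ‖f(t)‖ ≤ C·e^{−a·(t−T)} for all t ≥ T, for some constants C ≥ 0 and a > 0. Define g(t) = ξ₁·f(t) + ξ₂·∫_{t₀}^{t} γ^{t−τ}·f(τ) dτ. Then there exist constants C' ≥ 0 and μ > 0 such that ‖g(t)‖ ≤ C'·e^{−μ·(t−T)} for all t ≥ T (exponential convergence of the command-shaping output once the interaction input decays exponentially). -/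
open Real Set

/-- The integral of the kernel `exp (-c (t - τ))` over any interval ending at `t` is at most
`1 / c`. -/
theorem integral_exp_neg_mul_sub_le {c : ℝ} (hc : 0 < c) (s t : ℝ) :
    ∫ τ in s..t, Real.exp (-c * (t - τ)) ≤ 1 / c := by
  have hderiv : ∀ τ ∈ uIcc s t,
      HasDerivAt (fun τ => Real.exp (-c * (t - τ)) / c) (Real.exp (-c * (t - τ))) τ := by
    intro τ _
    have h := ((((hasDerivAt_id τ).const_sub t).const_mul (-c)).exp).div_const c
    refine h.congr_deriv ?_
    simp only [id]
    field_simp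
  rw [intervalIntegral.integral_eq_sub_of_hasDerivAt hderiv
    (Continuous.intervalIntegrable (by fun_prop) _ _)]
  have hpos : 0 ≤ Real.exp (-c * (t - s)) / c := by positivity
  simpa using hpos

/-- Convolution with `exp (-b s)` preserves a slower exponential decay rate `m < b`. -/
theorem norm_integral_exp_smul_le {E : Type*} [NormedAddCommGroup E] [NormedSpace ℝ E]
    {b m C s t T : ℝ} (hmb : m < b) (hC : 0 ≤ C) (hst : s ≤ t) {f : ℝ → E}
    (hf : ∀ τ ∈ Icc s t, ‖f τ‖ ≤ C * Real.exp (-m * (τ - T))) :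
    ‖∫ τ in s..t, Real.exp (-b * (t - τ)) • f τ‖ ≤ C / (b - m) * Real.exp (-m * (t - T)) := by
  have hbound : ∀ τ ∈ Ioc s t, ‖Real.exp (-b * (t - τ)) • f τ‖ ≤
      C * Real.exp (-m * (t - T)) * Real.exp (-(b - m) * (t - τ)) := by
    intro τ hτ
    rw [norm_smul, Real.norm_eq_abs, Real.abs_exp]
    calc Real.exp (-b * (t - τ)) * ‖f τ‖
        ≤ Real.exp (-b * (t - τ)) * (C * Real.exp (-m * (τ - T))) := by
          gcongr
          exact hf τ (Ioc_subset_Icc_self hτ)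
      _ = C * (Real.exp (-b * (t - τ)) * Real.exp (-m * (τ - T))) := by ring
      _ = C * (Real.exp (-m * (t - T)) * Real.exp (-(b - m) * (t - τ))) := by
          rw [← Real.exp_add, ← Real.exp_add]
          ring_nf
      _ = _ := by ring
  calc ‖∫ τ in s..t, Real.exp (-b * (t - τ)) • f τ‖
      ≤ ∫ τ in s..t, C * Real.exp (-m * (t - T)) * Real.exp (-(b - m) * (t - τ)) :=
        intervalIntegral.norm_integral_le_of_norm_le hst
          (Filter.Eventually.of_forall hbound)
          (Continuous.intervalIntegrable (by fun_prop) _ _)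
    _ = C * Real.exp (-m * (t - T)) * ∫ τ in s..t, Real.exp (-(b - m) * (t - τ)) :=
        intervalIntegral.integral_const_mul _ _
    _ ≤ C * Real.exp (-m * (t - T)) * (1 / (b - m)) := by
        gcongr
        exact integral_exp_neg_mul_sub_le (sub_pos.2 hmb) s t
    _ = C / (b - m) * Real.exp (-m * (t - T)) := by ring

/-- exponential convergence of the command-shaping output once
the interaction input decays exponentially. -/
theorem command_shaping_exponential_convergence
    (γ : ℝ) (hγ : γ ∈ Ioo (0:ℝ) 1) (t₀ T : ℝ) (hT : t₀ ≤ T)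
    (ξ₁ ξ₂ : Matrix (Fin 3) (Fin 3) ℝ)
    (f : ℝ → EuclideanSpace ℝ (Fin 3)) (hf : Continuous f)
    (C a : ℝ) (hC : 0 ≤ C) (ha : 0 < a)
    (hbd1 : ∀ t ∈ Icc t₀ T, ‖f t‖ ≤ C)
    (hbd2 : ∀ t ≥ T, ‖f t‖ ≤ C * Real.exp (-a * (t - T)))
    (g : ℝ → EuclideanSpace ℝ (Fin 3))
    (hg : ∀ t, g t = Matrix.toEuclideanLin ξ₁ (f t)
        + Matrix.toEuclideanLin ξ₂ (∫ τ in t₀..t, γ ^ (t - τ) • f τ)) :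
    ∃ C' : ℝ, 0 ≤ C' ∧ ∃ μ : ℝ, 0 < μ ∧
      ∀ t ≥ T, ‖g t‖ ≤ C' * Real.exp (-μ * (t - T)) := by
  obtain ⟨hγ0, hγ1⟩ := hγ
  set b : ℝ := -Real.log γ with hb
  have hb0 : 0 < b := neg_pos.2 (Real.log_neg hγ0 hγ1)
  set m : ℝ := min a (b / 2) with hm
  have hm0 : 0 < m := lt_min ha (half_pos hb0)
  have hma : m ≤ a := min_le_left _ _
  have hmb : m < b := (min_le_right _ _).trans_lt (half_lt_self hb0)
  have hdecay : ∀ τ, t₀ ≤ τ → ‖f τ‖ ≤ C * Real.exp (-m * (τ - T)) := by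
    intro τ hτ
    rcases le_total τ T with h | h
    · refine (hbd1 τ ⟨hτ, h⟩).trans (le_mul_of_one_le_right hC (Real.one_le_exp ?_))
      nlinarith
    · refine (hbd2 τ h).trans ?_
      have := sub_nonneg.2 h
      gcongr
  let A := (Matrix.toEuclideanLin ξ₁).toContinuousLinearMap
  let B := (Matrix.toEuclideanLin ξ₂).toContinuousLinearMap
  have hbm : 0 < b - m := sub_pos.2 hmb
  refine ⟨‖A‖ * C + ‖B‖ * (C / (b - m)), by positivity, m, hm0, fun t ht => ?_⟩
  have hpow : ∀ τ, γ ^ (t - τ) = Real.exp (-b * (t - τ)) := fun τ => by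
    rw [Real.rpow_def_of_pos hγ0, hb, neg_neg]
  have hI := norm_integral_exp_smul_le (T := T) hmb hC (hT.trans ht)
    (fun τ hτ => hdecay τ hτ.1)
  rw [hg t]
  simp only [hpow]
  calc ‖A (f t) + B (∫ τ in t₀..t, Real.exp (-b * (t - τ)) • f τ)‖
      ≤ ‖A‖ * ‖f t‖ + ‖B‖ * ‖∫ τ in t₀..t, Real.exp (-b * (t - τ)) • f τ‖ :=
        norm_add_le_of_le (A.le_opNorm _) (B.le_opNorm _)
    _ ≤ ‖A‖ * (C * Real.exp (-m * (t - T)))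
        + ‖B‖ * (C / (b - m) * Real.exp (-m * (t - T))) := by
        gcongr
        exact hdecay t (hT.trans ht)
    _ = (‖A‖ * C + ‖B‖ * (C / (b - m))) * Real.exp (-m * (t - T)) := by ring
end

section
/- Let a, b, c ∈ ℝ. Every complex root z of the polynomial X³ + a·X² + b·X + c has strictly negative real part if and only if a > 0, b > 0, c > 0 and a·b > c (Routh–Hurwitz criterion for a monic cubic; in the paper's notation a = K_D, b = K_P, c = K_I). -/
theorem exists_real_root_cubic (a b c : ℝ) : ∃ r : ℝ, r ^ 3 + a * r ^ 2 + b * r + c = 0 := by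
  have hcont : Continuous fun x : ℝ => x ^ 3 + a * x ^ 2 + b * x + c := by fun_prop
  obtain ⟨M, hM, hM1⟩ : ∃ M : ℝ, M = 1 + |a| + |b| + |c| ∧ 1 ≤ M :=
    ⟨_, rfl, by linarith [abs_nonneg a, abs_nonneg b, abs_nonneg c]⟩
  have hMsq : M ≤ M ^ 2 := by nlinarith
  have ha := mul_le_mul_of_nonneg_right (neg_abs_le a) (sq_nonneg M)
  have ha' := mul_le_mul_of_nonneg_right (le_abs_self a) (sq_nonneg M)
  have hb : |b * M| ≤ |b| * M ^ 2 := by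
    rw [abs_mul, abs_of_pos (by linarith : 0 < M)]
    exact mul_le_mul_of_nonneg_left hMsq (abs_nonneg b)
  have hc : |c| ≤ |c| * M ^ 2 := le_mul_of_one_le_right (abs_nonneg c) (by linarith)
  have hcube : M ^ 3 = M ^ 2 + |a| * M ^ 2 + |b| * M ^ 2 + |c| * M ^ 2 := by
    rw [pow_succ M 2]
    nth_rewrite 2 [hM]
    ring
  have hb₁ := abs_le.mp hb
  have hc₁ := abs_le.mp hc
  refine mem_range_of_exists_le_of_exists_ge hcont ⟨-M, ?_⟩ ⟨M, ?_⟩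
  · have hneg : (-M) ^ 3 + a * (-M) ^ 2 + b * (-M) + c = -M ^ 3 + a * M ^ 2 - b * M + c := by ring
    rw [hneg]
    linarith [sq_nonneg M]
  · linarith [sq_nonneg M]

theorem coeff_pos_of_quadratic_roots_re_neg {p q : ℝ}
    (h : ∀ z : ℂ, z ^ 2 + (p : ℂ) * z + (q : ℂ) = 0 → z.re < 0) : 0 < p ∧ 0 < q := by
  rcases le_total 0 (p ^ 2 - 4 * q) with hD | hD
  · have hs := Real.sq_sqrt hD
    have hs₀ := Real.sqrt_nonneg (p ^ 2 - 4 * q)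
    generalize √(p ^ 2 - 4 * q) = s at hs hs₀
    have hroot : ((-p + s) / 2) ^ 2 + p * ((-p + s) / 2) + q = 0 := by linarith
    have hre := h (((-p + s) / 2 : ℝ) : ℂ) (by exact_mod_cast hroot)
    rw [Complex.ofReal_re] at hre
    constructor <;> nlinarith
  · have hs := Real.sq_sqrt (neg_nonneg.mpr hD)
    generalize √(-(p ^ 2 - 4 * q)) = s at hs
    have hre := h ⟨-p / 2, s / 2⟩ (by
      apply Complex.ext
      · simp [pow_two]
        linarith
      · simp [pow_two]
        ring)
    dsimp only at hre
    constructor <;> nlinarith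

/-- Routh–Hurwitz criterion for a monic cubic with real
coefficients: all complex roots have strictly negative real part iff
a > 0, b > 0, c > 0 and a·b > c. -/
theorem routh_hurwitz_cubic (a b c : ℝ) :
    (∀ z : ℂ, z ^ 3 + (a : ℂ) * z ^ 2 + (b : ℂ) * z + (c : ℂ) = 0 → z.re < 0) ↔
      (0 < a ∧ 0 < b ∧ 0 < c ∧ c < a * b) := by
  constructor
  · intro h
    obtain ⟨r, hr⟩ := exists_real_root_cubic a b c
    have hr₀ : r < 0 := by simpa using h r (by exact_mod_cast hr)
    obtain ⟨p, hp⟩ : ∃ p, p = a + r := ⟨_, rfl⟩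
    obtain ⟨q, hq⟩ : ∃ q, q = b + r * p := ⟨_, rfl⟩
    obtain rfl : a = p - r := by linarith
    obtain rfl : b = q - r * p := by linarith
    obtain rfl : c = -r * q := by linarith
    obtain ⟨hp₀, hq₀⟩ : 0 < p ∧ 0 < q := by
      refine coeff_pos_of_quadratic_roots_re_neg fun z hz => h z ?_
      push_cast
      linear_combination (z - r) * hz
    have hpr : 0 < -r * p := mul_pos (neg_pos.mpr hr₀) hp₀
    refine ⟨by linarith, by linarith, mul_pos (neg_pos.mpr hr₀) hq₀, ?_⟩
    nlinarith [mul_pos hp₀ hq₀, mul_pos hpr hp₀, mul_pos hpr (neg_pos.mpr hr₀)]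
  · rintro ⟨ha, hb, hc, hab⟩ ⟨x, y⟩ hz
    have hre : x ^ 3 - 3 * x * y ^ 2 + a * (x ^ 2 - y ^ 2) + b * x + c = 0 := by
      have := congrArg Complex.re hz
      simp [pow_succ] at this
      linarith
    have him : y * (3 * x ^ 2 - y ^ 2 + 2 * a * x + b) = 0 := by
      have := congrArg Complex.im hz
      simp [pow_succ] at this
      linarith
    by_contra! hx
    dsimp only at hx
    rcases mul_eq_zero.mp him with rfl | hy
    · have : 0 < x ^ 3 + a * x ^ 2 + b * x + c := by positivity
      linarith
    · have : 0 ≤ 8 * x ^ 3 + 8 * a * x ^ 2 + 2 * b * x + 2 * a ^ 2 * x := by positivity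
      have hy' : y ^ 2 = 3 * x ^ 2 + 2 * a * x + b := by linarith
      rw [hy'] at hre
      linarith
end

section
/- Let K_P, K_I, K_D be positive reals with K_D·K_P > K_I. Then every three-times differentiable function e : ℝ → ℝ satisfying e'''(t) + K_D·e''(t) + K_P·e'(t) + K_I·e(t) = 0 for all t ≥ 0 converges to zero exponentially: there exist constants C ≥ 0 and μ > 0 such that |e(t)| ≤ C·e^{−μ·t} for all t ≥ 0 (exponential stability of the PID cable-length tracking error dynamics). -/
open Real

/-- A function with `V' ≤ -k V` on `[0, ∞)` decays at least as fast as `exp (-k t)`. -/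
theorem le_mul_exp_of_deriv_le_neg_mul {V V' : ℝ → ℝ} {k : ℝ}
    (hV : ∀ t ≥ (0 : ℝ), HasDerivAt V (V' t) t) (hle : ∀ t ≥ (0 : ℝ), V' t ≤ -(k * V t))
    {t : ℝ} (ht : 0 ≤ t) : V t ≤ V 0 * exp (-(k * t)) := by
  have hderiv : ∀ s ≥ (0 : ℝ), HasDerivAt (fun s => V s * exp (k * s))
      (V' s * exp (k * s) + V s * (exp (k * s) * k)) s := fun s hs => by
    refine ((hV s hs).mul (((hasDerivAt_id s).const_mul k).exp)).congr_deriv ?_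
    simp
  have hanti : AntitoneOn (fun s => V s * exp (k * s)) (Set.Ici 0) := by
    refine antitoneOn_of_hasDerivWithinAt_nonpos (convex_Ici 0)
      (fun s hs => (hderiv s hs).continuousAt.continuousWithinAt)
      (fun s hs => (hderiv s (interior_subset hs)).hasDerivWithinAt) fun s hs => ?_
    have h := mul_le_mul_of_nonneg_right (hle s (interior_subset hs)) (exp_pos (k * s)).le
    linarith
  have h : V t * exp (k * t) ≤ V 0 := by
    simpa using hanti Set.self_mem_Ici ht ht
  rw [exp_neg, ← div_eq_mul_inv]
  exact (le_div_iff₀ (exp_pos _)).2 h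

/-- Lyapunov function of `x''' + a x'' + b x' + c x = 0` in the coordinates
`(x, y, w) = (x, x', x'' + a x')`. -/
noncomputable def pidLyapunov (a b c ε x y w : ℝ) : ℝ :=
  w ^ 2 / 2 + b * y ^ 2 / 2 + a * c * x ^ 2 / 2 + c * x * y + ε * (x * w - y * (w - a * y))

/-- Derivative of `pidLyapunov` along the flow `x' = y`, `y' = w - a y`, `w' = -b y - c x`. -/
def pidLyapunovDeriv (a b c ε x y w : ℝ) : ℝ :=
  -(a * b - c) * y ^ 2 - ε * w ^ 2 - ε * c * x ^ 2
    + ε * ((3 * a + 1) * (w * y) + (b - 2 * a ^ 2) * y ^ 2 + (c - b) * (x * y))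

theorem hasDerivAt_pidLyapunov {a b c ε t : ℝ} {x y w : ℝ → ℝ} (hx : HasDerivAt x (y t) t)
    (hy : HasDerivAt y (w t - a * y t) t) (hw : HasDerivAt w (-b * y t - c * x t) t) :
    HasDerivAt (fun s => pidLyapunov a b c ε (x s) (y s) (w s))
      (pidLyapunovDeriv a b c ε (x t) (y t) (w t)) t := by
  unfold pidLyapunov pidLyapunovDeriv
  refine ((((((hw.pow 2).div_const 2).add (((hy.pow 2).const_mul b).div_const 2)).add
    (((hx.pow 2).const_mul (a * c)).div_const 2)).add ((hx.const_mul c).mul hy)).add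
    (((hx.mul hw).sub (hy.mul (hw.sub (hy.const_mul a)))).const_mul ε)).congr_deriv ?_
  simp
  ring

/-- Under the Routh–Hurwitz condition, the unperturbed Lyapunov function is coercive. -/
theorem exists_pos_mul_le_pidLyapunov_zero {a b c : ℝ} (ha : 0 < a) (hb : 0 < b) (hc : 0 < c)
    (h : c < a * b) :
    ∃ m > 0, ∀ x y w : ℝ, m * (x ^ 2 + y ^ 2 + w ^ 2) ≤ pidLyapunov a b c 0 x y w := by
  set q := c * (a * b - c) / (2 * (a * c + b)) with hq
  have hac : 0 < a * c + b := by positivity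
  have hq0 : 0 < q := div_pos (mul_pos hc (sub_pos.2 h)) (by positivity)
  refine ⟨min q (1 / 2), lt_min hq0 (by norm_num), fun x y w => ?_⟩
  have hquad : q * (x ^ 2 + y ^ 2) ≤ b * y ^ 2 / 2 + a * c * x ^ 2 / 2 + c * x * y := by
    rw [hq, div_mul_eq_mul_div, div_le_iff₀ (by positivity)]
    nlinarith [sq_nonneg (a * c * x + c * y), sq_nonneg (c * x + b * y)]
  have h₁ := mul_le_mul_of_nonneg_right (min_le_left q (1 / 2))
    (show 0 ≤ x ^ 2 + y ^ 2 by positivity)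
  have h₂ := mul_le_mul_of_nonneg_right (min_le_right q (1 / 2)) (sq_nonneg w)
  unfold pidLyapunov
  linarith

theorem abs_pidLyapunov_sub_zero_le {a ε : ℝ} (b c : ℝ) (ha : 0 ≤ a) (hε : 0 ≤ ε) (x y w : ℝ) :
    |pidLyapunov a b c ε x y w - pidLyapunov a b c 0 x y w|
      ≤ ε * (1 + a) * (x ^ 2 + y ^ 2 + w ^ 2) := by
  have hcross : |x * w - y * (w - a * y)| ≤ (1 + a) * (x ^ 2 + y ^ 2 + w ^ 2) := by
    have h₁ := mul_nonneg ha (sq_nonneg x)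
    have h₂ := mul_nonneg ha (sq_nonneg y)
    have h₃ := mul_nonneg ha (sq_nonneg w)
    rw [abs_le]
    constructor <;>
      nlinarith [sq_nonneg (x + w), sq_nonneg (x - w), sq_nonneg (y + w), sq_nonneg (y - w)]
  have heq : pidLyapunov a b c ε x y w - pidLyapunov a b c 0 x y w
      = ε * (x * w - y * (w - a * y)) := by
    unfold pidLyapunov; ring
  rw [heq, abs_mul, abs_of_nonneg hε, mul_assoc]
  exact mul_le_mul_of_nonneg_left hcross hε

theorem pidLyapunov_zero_le {a b c : ℝ} (ha : 0 ≤ a) (hb : 0 ≤ b) (hc : 0 ≤ c) (x y w : ℝ) :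
    pidLyapunov a b c 0 x y w ≤ (1 + b + a * c + c) * (x ^ 2 + y ^ 2 + w ^ 2) := by
  have hac := mul_nonneg ha hc
  have h₁ := mul_nonneg hc (sq_nonneg (x - y))
  unfold pidLyapunov
  nlinarith [mul_nonneg hb (sq_nonneg x), mul_nonneg hb (sq_nonneg y), mul_nonneg hb (sq_nonneg w),
    mul_nonneg hc (sq_nonneg x), mul_nonneg hc (sq_nonneg y), mul_nonneg hc (sq_nonneg w),
    mul_nonneg hac (sq_nonneg x), mul_nonneg hac (sq_nonneg y), mul_nonneg hac (sq_nonneg w)]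

/-- For small `ε`, the Lyapunov function decreases strictly along the flow. -/
theorem pidLyapunovDeriv_le {a b c ε : ℝ} (hc : 0 < c) (hε : 0 ≤ ε)
    (hsmall : ε * ((3 * a + 1) ^ 2 / 2 + b + (c - b) ^ 2 / (2 * c)) ≤ (a * b - c) / 2)
    (x y w : ℝ) :
    pidLyapunovDeriv a b c ε x y w
      ≤ -((a * b - c) / 2 * y ^ 2 + ε / 2 * w ^ 2 + ε * c / 2 * x ^ 2) := by
  have hxy : (c - b) * (x * y) ≤ c / 2 * x ^ 2 + (c - b) ^ 2 / (2 * c) * y ^ 2 := by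
    have heq : c / 2 * x ^ 2 + (c - b) ^ 2 / (2 * c) * y ^ 2 - (c - b) * (x * y)
        = (c * x - (c - b) * y) ^ 2 / (2 * c) := by
      field_simp
      ring
    have : 0 ≤ (c * x - (c - b) * y) ^ 2 / (2 * c) := by positivity
    linarith
  have hwy : (3 * a + 1) * (w * y) ≤ w ^ 2 / 2 + (3 * a + 1) ^ 2 / 2 * y ^ 2 := by
    linarith [sq_nonneg (w - (3 * a + 1) * y)]
  have hy : (b - 2 * a ^ 2) * y ^ 2 ≤ b * y ^ 2 := by
    linarith [sq_nonneg (a * y)]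
  have h₁ := mul_le_mul_of_nonneg_left (add_le_add (add_le_add hwy hy) hxy) hε
  have h₂ := mul_le_mul_of_nonneg_right hsmall (sq_nonneg y)
  unfold pidLyapunovDeriv
  linarith

theorem exists_pidLyapunov_strict {a b c : ℝ} (ha : 0 < a) (hb : 0 < b) (hc : 0 < c)
    (h : c < a * b) :
    ∃ ε : ℝ, ∃ m > 0, ∃ k > 0, ∀ x y w : ℝ, m * x ^ 2 ≤ pidLyapunov a b c ε x y w ∧
      pidLyapunovDeriv a b c ε x y w ≤ -(k * pidLyapunov a b c ε x y w) := by
  obtain ⟨m, hm, hcoer⟩ := exists_pos_mul_le_pidLyapunov_zero ha hb hc h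
  have hd : 0 < (a * b - c) / 2 := half_pos (sub_pos.2 h)
  set M := (3 * a + 1) ^ 2 / 2 + b + (c - b) ^ 2 / (2 * c)
  have hM0 : 0 < M := by positivity
  set ε := min (m / 2 / (1 + a)) ((a * b - c) / 2 / M)
  have hε : 0 < ε := lt_min (by positivity) (by positivity)
  have hεm : ε * (1 + a) ≤ m / 2 := (le_div_iff₀ (by positivity)).1 (min_le_left _ _)
  have hεM : ε * M ≤ (a * b - c) / 2 := (le_div_iff₀ hM0).1 (min_le_right _ _)
  set κ := min ((a * b - c) / 2) (min (ε / 2) (ε * c / 2))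
  have hκ : 0 < κ := lt_min hd (lt_min (by positivity) (by positivity))
  set L := 1 + b + a * c + c + ε * (1 + a) with hL
  have hL0 : 0 < L := by positivity
  refine ⟨ε, m / 2, by positivity, κ / L, by positivity, fun x y w => ?_⟩
  have hdiff := abs_le.1 (abs_pidLyapunov_sub_zero_le b c ha.le hε.le x y w)
  have hS : 0 ≤ x ^ 2 + y ^ 2 + w ^ 2 := by positivity
  constructor
  · have h₁ := mul_le_mul_of_nonneg_right hεm hS
    have h₂ : 0 ≤ m / 2 * (y ^ 2 + w ^ 2) := by positivity
    linarith [hcoer x y w, hdiff.1]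
  · have hupper : pidLyapunov a b c ε x y w ≤ L * (x ^ 2 + y ^ 2 + w ^ 2) := by
      rw [hL]
      linarith [pidLyapunov_zero_le ha.le hb.le hc.le x y w, hdiff.2]
    have hkV : κ / L * pidLyapunov a b c ε x y w ≤ κ * (x ^ 2 + y ^ 2 + w ^ 2) := by
      refine (mul_le_mul_of_nonneg_left hupper (by positivity)).trans_eq ?_
      field_simp
    have hy := mul_le_mul_of_nonneg_right (show κ ≤ (a * b - c) / 2 from min_le_left _ _)
      (sq_nonneg y)
    have hw := mul_le_mul_of_nonneg_right
      (show κ ≤ ε / 2 from (min_le_right _ _).trans (min_le_left _ _)) (sq_nonneg w)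
    have hx := mul_le_mul_of_nonneg_right
      (show κ ≤ ε * c / 2 from (min_le_right _ _).trans (min_le_right _ _)) (sq_nonneg x)
    linarith [pidLyapunovDeriv_le hc hε.le hεM x y w]

/-- exponential stability of the PID cable-length tracking
error dynamics. -/
theorem pid_error_exponential_stability
    (KP KI KD : ℝ) (hKP : 0 < KP) (hKI : 0 < KI) (hKD : 0 < KD)
    (hRH : KI < KD * KP)
    (e : ℝ → ℝ)
    (he : Differentiable ℝ e)
    (he' : Differentiable ℝ (deriv e))
    (he'' : Differentiable ℝ (deriv (deriv e)))
    (hODE : ∀ t ≥ (0:ℝ),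
      deriv (deriv (deriv e)) t + KD * deriv (deriv e) t
        + KP * deriv e t + KI * e t = 0) :
    ∃ C : ℝ, 0 ≤ C ∧ ∃ μ : ℝ, 0 < μ ∧
      ∀ t ≥ (0:ℝ), |e t| ≤ C * Real.exp (-μ * t) := by
  obtain ⟨ε, m, hm, k, hk, hLyap⟩ := exists_pidLyapunov_strict hKD hKP hKI hRH
  set w : ℝ → ℝ := fun t => deriv (deriv e) t + KD * deriv e t with hw
  set V : ℝ → ℝ := fun t => pidLyapunov KD KP KI ε (e t) (deriv e t) (w t)
  have hV : ∀ t ≥ (0 : ℝ), HasDerivAt V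
      (pidLyapunovDeriv KD KP KI ε (e t) (deriv e t) (w t)) t := fun t ht => by
    refine hasDerivAt_pidLyapunov (he t).hasDerivAt ?_ ?_
    · refine (he' t).hasDerivAt.congr_deriv ?_
      simp [hw]
    · refine ((he'' t).hasDerivAt.add ((he' t).hasDerivAt.const_mul KD)).congr_deriv ?_
      linarith [hODE t ht]
  refine ⟨√(V 0 / m), sqrt_nonneg _, k / 2, half_pos hk, fun t ht => ?_⟩
  have hdecay := le_mul_exp_of_deriv_le_neg_mul hV (fun s _ => (hLyap _ _ _).2) ht
  have hV0 : 0 ≤ V 0 / m :=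
    div_nonneg ((mul_nonneg hm.le (sq_nonneg _)).trans (hLyap _ _ _).1) hm.le
  refine abs_le_of_sq_le_sq ?_ (by positivity)
  rw [mul_pow, sq_sqrt hV0, ← exp_nat_mul, div_mul_eq_mul_div, le_div_iff₀ hm]
  calc e t ^ 2 * m = m * e t ^ 2 := mul_comm _ _
    _ ≤ V t := (hLyap _ _ _).1
    _ ≤ V 0 * exp (-(k * t)) := hdecay
    _ = V 0 * exp ((2 : ℕ) * (-(k / 2) * t)) := by
      congr 2
      push_cast
      ring
end
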